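/- Trace-class criterion (operator form of Theorem 5.1): let E be a complex Hilbert space with a Hilbert basis (e_n)_{n∈ℕ}, let r > 1 be real, and let c : ℕ×ℕ → ℂ satisfy Σ := ∑_{m,n} (2m+1)^r |c_{mn}|² < ∞. Then there exist bounded linear operators B and C on E such that ∑_m ‖B e_m‖² = Σ, ∑_n ‖C e_n‖² ≤ (1 − 2^{−r}) ζ(r), and for every n, (B ∘ C) e_n = ∑_m c_{mn} e_m (the series converging in E); in particular the operator with matrix c in the basis (e_n) is a composition of two Hilbert–Schmidt operators, with the product of their Hilbert–Schmidt norms at most ((1 − 2^{−r}) ζ(r))^{1/2} Σ^{1/2}. -/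

import Mathlib

noncomputable section

/-- The Riemann zeta value `ζ(r) = ∑_{k=1}^∞ k^{-r}` for real `r`. -/
def zetaR (r : ℝ) : ℝ := ∑' k : ℕ, ((k : ℝ) + 1) ^ (-r)

open scoped ENNReal InnerProductSpace

section
variable {E : Type*} [NormedAddCommGroup E] [InnerProductSpace ℂ E] [CompleteSpace E]

theorem aux_contraction (S A : E →L[ℂ] E) (h : ∀ x, ‖S x‖ = ‖A x‖) :
    ∃ W : E →L[ℂ] E, (∀ x, ‖W x‖ ≤ ‖x‖) ∧ ∀ x, W (S x) = A x := by
  let K : Submodule ℂ E := (LinearMap.range S.toLinearMap).topologicalClosure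
  have : CompleteSpace K := (Submodule.isClosed_topologicalClosure _).completeSpace_coe
  have hm : ∀ x, S x ∈ K := fun x => Submodule.le_topologicalClosure _ ⟨x, rfl⟩
  let s : E →ₗ[ℂ] K := S.toLinearMap.codRestrict K hm
  have hd : DenseRange s := by
    intro y
    rw [Topology.IsInducing.subtypeVal.closure_eq_preimage_closure_image]
    have hy := y.2
    change (y : E) ∈ closure (Set.image Subtype.val (Set.range s))
    have : (Set.image Subtype.val (Set.range s)) = (LinearMap.range S.toLinearMap : Set E) := by
      ext z; simp [s]
    rw [this]
    exact hy
  have hn : ∀ x, ‖A.toLinearMap x‖ ≤ 1 * ‖s x‖ := fun x => by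
    simp only [one_mul, ContinuousLinearMap.coe_coe]
    exact (h x).symm.le
  let f : K →L[ℂ] E := A.toLinearMap.extendOfNorm s
  refine ⟨f ∘L K.orthogonalProjectionOnto, fun x => ?_, fun x => ?_⟩
  · have := LinearMap.norm_extendOfNorm_apply_le hd 1 hn (K.orthogonalProjectionOnto x)
    rw [one_mul] at this
    exact this.trans (Submodule.norm_orthogonalProjectionOnto_apply_le K x)
  · have h1 : K.orthogonalProjectionOnto (S x) = s x :=
      Submodule.orthogonalProjectionOnto_mem_subspace_eq_self (K := K) (s x)
    have := LinearMap.extendOfNorm_eq hd ⟨1, hn⟩ x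
    simpa [h1] using this

theorem aux_polar (A : E →L[ℂ] E) :
    ∃ W : E →L[ℂ] E, (∀ x, ‖W x‖ ≤ ‖x‖) ∧
      (∀ x, ‖ContinuousLinearMap.adjoint W x‖ ≤ ‖x‖) ∧ A = W ∘L (ContinuousLinearMap.adjoint A) ∘L W := by
  set S : E →L[ℂ] E := CFC.abs A with hS
  have hsa : ContinuousLinearMap.adjoint S = S := by
    have : IsSelfAdjoint S := (CFC.abs_nonneg A).isSelfAdjoint
    exact this
  have hSS : S * S = star A * A := CFC.abs_mul_abs A
  have hn : ∀ x, ‖S x‖ = ‖A x‖ := fun x => by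
    have h1 : (⟪S x, S x⟫_ℂ) = ⟪A x, A x⟫_ℂ := by
      rw [← ContinuousLinearMap.adjoint_inner_right S, ← ContinuousLinearMap.adjoint_inner_right A, hsa]
      have := congrArg (fun T : E →L[ℂ] E => T x) hSS
      exact congrArg (fun y => ⟪x, y⟫_ℂ) this
    rw [inner_self_eq_norm_sq_to_K, inner_self_eq_norm_sq_to_K] at h1
    have h2 : ‖S x‖ ^ 2 = ‖A x‖ ^ 2 := by exact_mod_cast h1
    exact (pow_left_inj₀ (norm_nonneg _) (norm_nonneg _) two_ne_zero).1 h2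
  obtain ⟨W, hW, hWS⟩ := aux_contraction S A hn
  have hWn : ‖W‖ ≤ 1 := W.opNorm_le_bound zero_le_one (by simpa using hW)
  have hWa : ∀ x, ‖ContinuousLinearMap.adjoint W x‖ ≤ ‖x‖ := fun x => by
    have h1 := (ContinuousLinearMap.adjoint W).le_opNorm x
    rw [LinearIsometryEquiv.norm_map] at h1
    nlinarith [norm_nonneg x]
  have key : ∀ x, ContinuousLinearMap.adjoint W (W (S x)) = S x := fun x => by
    have h0 : ‖W (S x)‖ = ‖S x‖ := by rw [hWS, hn]
    have h1 := @norm_sub_sq ℂ E _ _ _ (ContinuousLinearMap.adjoint W (W (S x))) (S x)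
    rw [ContinuousLinearMap.adjoint_inner_left, inner_self_eq_norm_sq, h0] at h1
    have h2 := hWa (W (S x))
    rw [h0] at h2
    have h3 : ‖ContinuousLinearMap.adjoint W (W (S x)) - S x‖ ^ 2 ≤ 0 := by
      nlinarith [norm_nonneg (ContinuousLinearMap.adjoint W (W (S x))), norm_nonneg (S x)]
    have h4 : ‖ContinuousLinearMap.adjoint W (W (S x)) - S x‖ = 0 := by
      nlinarith [norm_nonneg (ContinuousLinearMap.adjoint W (W (S x)) - S x)]
    exact sub_eq_zero.1 (norm_eq_zero.1 h4)
  have e1 : ContinuousLinearMap.adjoint W ∘L W ∘L S = S := by ext x; exact key x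
  have e2 : W ∘L S = A := by ext x; exact hWS x
  have e3 := congrArg ContinuousLinearMap.adjoint e1
  rw [ContinuousLinearMap.adjoint_comp, ContinuousLinearMap.adjoint_comp,
    ContinuousLinearMap.adjoint_adjoint, hsa] at e3
  have e4 : ContinuousLinearMap.adjoint A = S ∘L ContinuousLinearMap.adjoint W := by
    rw [← e2, ContinuousLinearMap.adjoint_comp, hsa]
  refine ⟨W, hW, hWa, ?_⟩
  rw [e4, e3, e2]

theorem aux_parseval (e : HilbertBasis ℕ ℂ E) (x : E) :
    HasSum (fun n => ‖⟪e n, x⟫_ℂ‖ ^ 2) (‖x‖ ^ 2) := by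
  have h := lp.hasSum_norm (p := 2) (by norm_num) (e.repr x)
  simp only [LinearIsometryEquiv.norm_map, HilbertBasis.repr_apply_apply] at h
  exact_mod_cast h

theorem aux_parseval_e (e : HilbertBasis ℕ ℂ E) (x : E) :
    ∑' n, ‖⟪e n, x⟫_ℂ‖ₑ ^ 2 = ‖x‖ₑ ^ 2 := by
  have h := aux_parseval e x
  have h2 := ENNReal.ofReal_tsum_of_nonneg (fun n => sq_nonneg ‖⟪e n, x⟫_ℂ‖) h.summable
  rw [h.tsum_eq] at h2
  simpa [ENNReal.ofReal_pow, ofReal_norm] using h2.symm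

theorem aux_hs_adjoint (e : HilbertBasis ℕ ℂ E) (T : E →L[ℂ] E) :
    ∑' n, ‖ContinuousLinearMap.adjoint T (e n)‖ₑ ^ 2 = ∑' n, ‖T (e n)‖ₑ ^ 2 := by
  simp_rw [← aux_parseval_e e]
  rw [ENNReal.tsum_comm]
  refine tsum_congr fun m => tsum_congr fun n => ?_
  rw [ContinuousLinearMap.adjoint_inner_right, ← inner_conj_symm, RCLike.enorm_conj]

theorem aux_op (e : HilbertBasis ℕ ℂ E) (g : ℕ → E) (hg : Summable fun n => ‖g n‖ ^ 2) :
    ∃ T : E →L[ℂ] E, ∀ n, T (e n) = g n := by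
  have hh : ∀ x : E, Summable (fun n => ‖⟪e n, x⟫_ℂ‖ * ‖g n‖) ∧
      ∑' n, ‖⟪e n, x⟫_ℂ‖ * ‖g n‖ ≤ ‖x‖ * √(∑' n, ‖g n‖ ^ 2) := fun x => by
    have hx := aux_parseval e x
    have := Real.summable_and_inner_le_Lp_mul_Lq_tsum_of_nonneg Real.HolderConjugate.two_two
      (f := fun n => ‖⟪e n, x⟫_ℂ‖) (g := fun n => ‖g n‖) (fun _ => norm_nonneg _) (fun _ => norm_nonneg _)
      (by exact_mod_cast hx.summable) (by exact_mod_cast hg)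
    refine ⟨this.1, this.2.trans_eq ?_⟩
    norm_cast
    rw [hx.tsum_eq]
    push_cast
    rw [← Real.sqrt_eq_rpow, ← Real.sqrt_eq_rpow, Real.sqrt_sq (norm_nonneg _)]
  have hs : ∀ x : E, Summable (fun n => ⟪e n, x⟫_ℂ • g n) := fun x =>
    Summable.of_norm (by simpa only [norm_smul] using (hh x).1)
  let L : E →ₗ[ℂ] E :=
    { toFun := fun x => ∑' n, ⟪e n, x⟫_ℂ • g n
      map_add' := fun x y => by
        simp only [inner_add_right, add_smul]
        exact (hs x).tsum_add (hs y)
      map_smul' := fun a x => by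
        simp only [inner_smul_right, mul_smul, RingHom.id_apply]
        exact (hs x).tsum_const_smul a }
  refine ⟨L.mkContinuous (√(∑' n, ‖g n‖ ^ 2)) fun x => ?_, fun n => ?_⟩
  · rw [mul_comm]
    refine le_trans ?_ (hh x).2
    have := norm_tsum_le_tsum_norm (f := fun n => ⟪e n, x⟫_ℂ • g n) (by simpa only [norm_smul] using (hh x).1)
    simp only [norm_smul] at this
    exact this
  · change ∑' m, ⟪e m, e n⟫_ℂ • g m = g n
    rw [tsum_eq_single n]
    · simp [e.orthonormal.1 n]
    · intro m hm
      rw [e.orthonormal.2 hm, zero_smul]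

theorem aux_conv (f : ℕ → E) (a : ℝ) (ha : 0 ≤ a)
    (h : ∑' n, ‖f n‖ₑ ^ 2 ≤ ENNReal.ofReal a) :
    Summable (fun n => ‖f n‖ ^ 2) ∧ ∑' n, ‖f n‖ ^ 2 ≤ a := by
  have hb : ∀ s : Finset ℕ, ∑ n ∈ s, ‖f n‖ ^ 2 ≤ a := fun s => by
    have h1 := (ENNReal.sum_le_tsum s).trans h
    rw [← ENNReal.ofReal_le_ofReal_iff ha, ENNReal.ofReal_sum_of_nonneg (fun _ _ => sq_nonneg _)]
    simpa [ENNReal.ofReal_pow, ofReal_norm] using h1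
  have hs := summable_of_sum_le (fun n => sq_nonneg ‖f n‖) hb
  exact ⟨hs, hs.tsum_le_of_sum_le hb⟩

end


theorem aux_zeta (r : ℝ) (hr : 1 < r) :
    HasSum (fun m : ℕ => (2 * (m : ℝ) + 1) ^ (-r)) ((1 - 2 ^ (-r)) * zetaR r) := by
  have h0 : Summable (fun k : ℕ => ((k : ℝ) + 1) ^ (-r)) := by
    have := (summable_nat_add_iff 1).2 (Real.summable_nat_rpow (p := -r) |>.2 (by linarith))
    exact_mod_cast this
  have hinj : Function.Injective (fun m : ℕ => 2 * m) := fun a b h => by simpa using h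
  have h1 : Summable (fun m : ℕ => (2 * (m : ℝ) + 1) ^ (-r)) := by
    have := h0.comp_injective hinj
    simpa [Function.comp_def] using this
  have h2 : HasSum (fun m : ℕ => (((2 * m + 1 : ℕ) : ℝ) + 1) ^ (-r)) (2 ^ (-r) * zetaR r) := by
    have := h0.hasSum.mul_left (2 ^ (-r))
    have hfun : (fun m : ℕ => (((2 * m + 1 : ℕ) : ℝ) + 1) ^ (-r)) =
        fun m : ℕ => (2 : ℝ) ^ (-r) * ((m : ℝ) + 1) ^ (-r) := by
      funext m
      rw [← Real.mul_rpow (by norm_num) (by positivity)]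
      congr 1
      push_cast
      ring
    rw [hfun]
    exact this
  have h3 : HasSum (fun m : ℕ => (((2 * m : ℕ) : ℝ) + 1) ^ (-r)) (∑' m : ℕ, (2 * (m : ℝ) + 1) ^ (-r)) := by
    simpa using h1.hasSum
  have h4 := HasSum.even_add_odd (f := fun k : ℕ => ((k : ℝ) + 1) ^ (-r)) h3 h2
  have h5 : _ = zetaR r := h4.tsum_eq.symm
  have h6 : (1 - 2 ^ (-r)) * zetaR r = ∑' m : ℕ, (2 * (m : ℝ) + 1) ^ (-r) := by linarith
  rw [h6]; exact h1.hasSum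

/-- trace-class criterion, operator form: let `E` be a complex
Hilbert space with Hilbert basis `(e_n)`, `r > 1`, and
`Σ = ∑_{m,n} (2m+1)^r |c_{mn}|² < ∞`.  Then there are bounded operators `B, C`
on `E` with `∑_m ‖B e_m‖² = Σ`, `∑_n ‖C e_n‖² ≤ (1 − 2^{−r}) ζ(r)`, and
`(B ∘ C) e_n = ∑_m c_{mn} e_m` for every `n`; in particular the operator with
matrix `c` is a composition of two Hilbert–Schmidt operators. -/
theorem trace_class_criterion
    {E : Type*} [NormedAddCommGroup E] [InnerProductSpace ℂ E] [CompleteSpace E]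
    (e : HilbertBasis ℕ ℂ E)
    (r : ℝ) (hr : 1 < r) (c : ℕ × ℕ → ℂ)
    (hc : Summable fun mn : ℕ × ℕ => (2 * (mn.1 : ℝ) + 1) ^ r * ‖c mn‖ ^ 2) :
    ∃ B C : E →L[ℂ] E,
      Summable (fun m : ℕ => ‖B (e m)‖ ^ 2) ∧
      (∑' m : ℕ, ‖B (e m)‖ ^ 2) =
        ∑' mn : ℕ × ℕ, (2 * (mn.1 : ℝ) + 1) ^ r * ‖c mn‖ ^ 2 ∧
      Summable (fun n : ℕ => ‖C (e n)‖ ^ 2) ∧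
      (∑' n : ℕ, ‖C (e n)‖ ^ 2) ≤ (1 - 2 ^ (-r)) * zetaR r ∧
      ∀ n : ℕ, HasSum (fun m : ℕ => c (m, n) • e m) ((B ∘L C) (e n)) := by
  classical
  set σ : ℝ := ∑' mn : ℕ × ℕ, (2 * (mn.1 : ℝ) + 1) ^ r * ‖c mn‖ ^ 2 with hσ
  have hpos : ∀ m : ℕ, (0 : ℝ) < 2 * (m : ℝ) + 1 := fun m => by positivity
  have hσ0 : 0 ≤ σ := tsum_nonneg fun mn => by have := hpos mn.1; positivity
  have hz := aux_zeta r hr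
  set lam : ℝ := (1 - 2 ^ (-r)) * zetaR r with hlam
  have hl0 : 0 ≤ lam := hz.nonneg fun m => by have := hpos m; positivity
  -- the diagonal operator
  have hdn : ∀ n : ℕ, ‖(((2 * (n : ℝ) + 1) ^ (-(r / 2)) : ℝ) : ℂ) • e n‖ ^ 2
      = (2 * (n : ℝ) + 1) ^ (-r) := fun n => by
    have := hpos n
    rw [norm_smul, e.orthonormal.1 n, mul_one, Complex.norm_real, Real.norm_eq_abs, sq_abs,
      ← Real.rpow_natCast, ← Real.rpow_mul this.le]
    congr 1
    push_cast
    ring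
  obtain ⟨D, hD⟩ := aux_op e (fun n => (((2 * (n : ℝ) + 1) ^ (-(r / 2)) : ℝ) : ℂ) • e n)
    (by simp_rw [hdn]; exact hz.summable)
  -- the weighted operator
  let g : ℕ → ℕ → ℂ := fun n m => (((2 * (m : ℝ) + 1) ^ (r / 2) : ℝ) : ℂ) * c (m, n)
  have hg : ∀ n m, ‖g n m‖ ^ 2 = (2 * (m : ℝ) + 1) ^ r * ‖c (m, n)‖ ^ 2 := fun n m => by
    have := hpos m
    rw [norm_mul, mul_pow, Complex.norm_real, Real.norm_eq_abs, sq_abs,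
      ← Real.rpow_natCast, ← Real.rpow_mul this.le]
    congr 2
    push_cast
    ring
  have hcs : HasSum (fun nm : ℕ × ℕ => ‖g nm.1 nm.2‖ ^ 2) σ := by
    simp_rw [hg]
    exact (Equiv.prodComm ℕ ℕ).hasSum_iff.2 hc.hasSum
  have hcol : ∀ n, Summable fun m => ‖g n m‖ ^ 2 := fun n => hcs.summable.prod_factor n
  have hmem : ∀ n, Memℓp (g n) 2 := fun n => by
    refine memℓp_gen ?_
    have := hcol n
    simpa using this
  let v : ℕ → E := fun n => e.repr.symm ⟨g n, hmem n⟩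
  have hv : ∀ n, HasSum (fun m => g n m • e m) (v n) := fun n =>
    e.hasSum_repr_symm ⟨g n, hmem n⟩
  have hvi : ∀ n m, ⟪e m, v n⟫_ℂ = g n m := fun n m => by
    rw [← e.repr_apply_apply]
    simp [v]
  have hvn : ∀ n, HasSum (fun m => ‖g n m‖ ^ 2) (‖v n‖ ^ 2) := fun n => by
    have := aux_parseval e (v n)
    simpa only [hvi] using this
  have hvs : HasSum (fun n => ‖v n‖ ^ 2) σ := hcs.prod_fiberwise hvn
  obtain ⟨G, hG⟩ := aux_op e v hvs.summable
  have hDE : ∑' n, ‖D (e n)‖ₑ ^ 2 = ENNReal.ofReal lam := by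
    rw [← hz.tsum_eq, ENNReal.ofReal_tsum_of_nonneg
      (fun n => by have := hpos n; positivity) hz.summable]
    refine tsum_congr fun n => ?_
    rw [hD, ← hdn, ENNReal.ofReal_pow (norm_nonneg _), ofReal_norm]
  have hGE : ∑' n, ‖G (e n)‖ₑ ^ 2 = ENNReal.ofReal σ := by
    rw [← hvs.tsum_eq, ENNReal.ofReal_tsum_of_nonneg (fun n => sq_nonneg _) hvs.summable]
    refine tsum_congr fun n => ?_
    rw [hG, ENNReal.ofReal_pow (norm_nonneg _), ofReal_norm]
  have hA : ∀ n, HasSum (fun m : ℕ => c (m, n) • e m) ((D ∘L G) (e n)) := fun n => by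
    have h1 := (hv n).mapL D
    rw [ContinuousLinearMap.comp_apply, hG]
    convert h1 using 2 with m
    have := hpos m
    rw [map_smul, hD, smul_smul]
    congr 1
    symm
    simp only [g]
    rw [mul_right_comm, ← Complex.ofReal_mul, ← Real.rpow_add this]
    simp
  obtain ⟨W, hW, hWa, hWA⟩ := aux_polar (D ∘L G)
  rw [ContinuousLinearMap.adjoint_comp] at hWA
  set B₀ : E →L[ℂ] E := W ∘L ContinuousLinearMap.adjoint G with hB₀
  set C₀ : E →L[ℂ] E := ContinuousLinearMap.adjoint D ∘L W with hC₀
  have hBC : D ∘L G = B₀ ∘L C₀ := hWA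
  have hen : ∀ {x y : E}, ‖x‖ ≤ ‖y‖ → ‖x‖ₑ ^ 2 ≤ ‖y‖ₑ ^ 2 := fun {x y} h => by
    gcongr
    exact enorm_le_iff_norm_le.2 h
  have hBs := aux_conv (fun n => B₀ (e n)) σ hσ0 (by
    rw [← hGE, ← aux_hs_adjoint e G]
    exact ENNReal.tsum_le_tsum fun n => hen (hW _))
  have hCs := aux_conv (fun n => C₀ (e n)) lam hl0 (by
    rw [← hDE, ← aux_hs_adjoint e C₀, hC₀, ContinuousLinearMap.adjoint_comp,
      ContinuousLinearMap.adjoint_adjoint]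
    exact ENNReal.tsum_le_tsum fun n => hen (hWa _))
  set β : ℝ := ∑' n, ‖B₀ (e n)‖ ^ 2 with hβ
  have hβ0 : 0 ≤ β := tsum_nonneg fun n => sq_nonneg _
  rcases hβ0.eq_or_lt with h0 | h0
  · have hz0 : ∀ n, B₀ (e n) = 0 := fun n => by
      have h1 := hBs.1.hasSum
      rw [← hβ, ← h0, hasSum_zero_iff_of_nonneg (fun n => sq_nonneg _)] at h1
      have := congrFun h1 n
      simpa using this
    have hB0 : ∀ x, B₀ x = 0 := fun x => by
      have := (e.hasSum_repr x).mapL B₀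
      simp only [map_smul, hz0, smul_zero] at this
      exact this.unique hasSum_zero
    refine ⟨G, 0, ?_, ?_, ?_, ?_, fun n => ?_⟩
    · simp_rw [hG]; exact hvs.summable
    · simp_rw [hG]; exact hvs.tsum_eq
    · simpa using summable_zero
    · simpa using hl0
    · have := hA n
      rw [hBC, ContinuousLinearMap.comp_apply, hB0] at this
      simpa using this
  · have ht1 : 1 ≤ σ / β := (one_le_div h0).2 hBs.2
    have htp : 0 < σ / β := by linarith
    set t : ℝ := √(σ / β) with ht
    have ht0 : 0 < t := Real.sqrt_pos.2 htp
    have htt : t ^ 2 = σ / β := Real.sq_sqrt htp.le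
    have hBn : ∀ n, ‖((t : ℂ) • B₀) (e n)‖ ^ 2 = σ / β * ‖B₀ (e n)‖ ^ 2 := fun n => by
      rw [ContinuousLinearMap.smul_apply, norm_smul, mul_pow, Complex.norm_real, Real.norm_eq_abs,
        sq_abs, htt]
    have hCn : ∀ n, ‖((t : ℂ)⁻¹ • C₀) (e n)‖ ^ 2 = (σ / β)⁻¹ * ‖C₀ (e n)‖ ^ 2 := fun n => by
      rw [ContinuousLinearMap.smul_apply, norm_smul, mul_pow, norm_inv, Complex.norm_real,
        Real.norm_eq_abs, inv_pow, sq_abs, htt]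
    refine ⟨(t : ℂ) • B₀, (t : ℂ)⁻¹ • C₀, ?_, ?_, ?_, ?_, fun n => ?_⟩
    · simp_rw [hBn]; exact hBs.1.mul_left _
    · simp_rw [hBn]; rw [tsum_mul_left, ← hβ]; field_simp
    · simp_rw [hCn]; exact hCs.1.mul_left _
    · simp_rw [hCn]; rw [tsum_mul_left]
      have h1 : (σ / β)⁻¹ ≤ 1 := inv_le_one_of_one_le₀ ht1
      have h2 : 0 ≤ ∑' n, ‖C₀ (e n)‖ ^ 2 := tsum_nonneg fun n => sq_nonneg _
      exact (mul_le_of_le_one_left h2 h1).trans hCs.2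
    · have := hA n
      rw [hBC] at this
      have htc : (t : ℂ) ≠ 0 := by exact_mod_cast ht0.ne'
      have hcomp : ((t : ℂ) • B₀) ∘L ((t : ℂ)⁻¹ • C₀) = B₀ ∘L C₀ := by
        rw [ContinuousLinearMap.smul_comp, ContinuousLinearMap.comp_smul, smul_smul,
          mul_inv_cancel₀ htc, one_smul]
      rw [hcomp]
      exact this
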